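/- Let X be a separable Banach space and let T be a well-founded closed A-tree on X. Then h(T) < ω₁, i.e., there exists a countable ordinal α with T^α = ∅. -/

import Mathlib

open Metric Set Topology

noncomputable section

/-- Transfinite iteration of a derivation `d` starting from `a`;
meets are taken at limit stages. -/
def derivIter {L : Type*} [CompleteLattice L] (d : L → L) (a : L) (α : Ordinal) : L :=
  Ordinal.limitRecOn α a (fun _ ih => d ih) (fun o _ ih => ⨅ (γ : Ordinal) (h : γ < o), ih γ h)

/-- The weak topology of a real normed space. -/
def weakTop (X : Type*) [NormedAddCommGroup X] [NormedSpace ℝ X] : TopologicalSpace X :=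
  TopologicalSpace.induced (fun (x : X) (f : X →L[ℝ] ℝ) => f x) inferInstance

variable {X : Type*} [NormedAddCommGroup X] [NormedSpace ℝ X]

/-- The dentability derivation `d_ε^1`. -/
def dentDeriv (ε : ℝ) (C : Set X) : Set X :=
  C \ ⋃ (f : X →L[ℝ] ℝ) (a : ℝ) (_ : Metric.diam ({y | a < f y} ∩ C) < ε), {y | a < f y}

/-- The weak fragmentation derivation `σ_ε^1`. -/
def weakDeriv (ε : ℝ) (C : Set X) : Set X :=
  C \ ⋃ (V : Set X) (_ : IsOpen[weakTop X] V) (_ : Metric.diam (V ∩ C) < ε), V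

/-- The convex weak fragmentation derivation `γ_ε^1`. -/
def convDeriv (ε : ℝ) (C : Set X) : Set X :=
  closure (convexHull ℝ (weakDeriv ε C))

/-- `treeRoot C δ α x` : `x` is the root of a `δ`-`α`-tree contained in `C`. -/
def treeRoot (C : Set X) (δ : ℝ) (α : Ordinal) : X → Prop :=
  Ordinal.limitRecOn α (fun x => x ∈ C)
    (fun _ ih x => x ∈ C ∧ ∃ y z : X,
      x = (2⁻¹ : ℝ) • (y + z) ∧ δ ≤ 2⁻¹ * ‖y - z‖ ∧ ih y ∧ ih z)
    (fun o _ ih x => ∀ γ (h : γ < o), ih γ h x)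

/-- `sprawlRoot C δ α x` : `x` is the root of a `δ`-`α`-sprawling tree contained in `C`. -/
def sprawlRoot (C : Set X) (δ : ℝ) (α : Ordinal) : X → Prop :=
  Ordinal.limitRecOn α (fun x => x ∈ C)
    (fun _ ih x => x ∈ C ∧ ∃ y z : ℕ → X,
      (∀ n, x = (2⁻¹ : ℝ) • (y n + z n)) ∧
      (∀ n m, n ≠ m → δ ≤ ‖y n - y m‖) ∧
      (∀ n, ih (y n)) ∧ (∀ n, ih (z n)))
    (fun o _ ih x => ∀ γ (h : γ < o), ih γ h x)

/-- `bushRoot C δ α x` : `x` is the root of a `δ`-`α`-bush contained in `C`. -/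
def bushRoot (C : Set X) (δ : ℝ) (α : Ordinal) : X → Prop :=
  Ordinal.limitRecOn α (fun x => x ∈ C)
    (fun _ ih x => x ∈ C ∧ ∃ (n : ℕ) (y : Fin (n + 1) → X) (lam : Fin (n + 1) → ℝ),
      (∀ i, 0 < lam i ∧ lam i ≤ 1) ∧ (∑ i, lam i = 1) ∧
      x = ∑ i, lam i • y i ∧ (∀ i, δ ≤ ‖x - y i‖) ∧ ∀ i, ih (y i))
    (fun o _ ih x => ∀ γ (h : γ < o), ih γ h x)

/-- `X` has the Slice Point of Continuity Property. -/
def SlicePCP (X : Type*) [NormedAddCommGroup X] [NormedSpace ℝ X] : Prop :=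
  ∀ A : Set X, A.Nonempty → Bornology.IsBounded A → ∀ ε > (0 : ℝ),
    ∃ (f : X →L[ℝ] ℝ) (a : ℝ), ({y | a < f y} ∩ A).Nonempty ∧
      ∀ x ∈ {y | a < f y} ∩ A, ∃ V ∈ @nhds X (weakTop X) x, Metric.diam (V ∩ A) < ε

section DerivIter

variable {L : Type*} [CompleteLattice L] (d : L → L) (a : L)

theorem derivIter_zero : derivIter d a 0 = a :=
  Ordinal.limitRecOn_zero ..

theorem derivIter_add_one (α : Ordinal) : derivIter d a (α + 1) = d (derivIter d a α) :=
  Ordinal.limitRecOn_add_one ..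

theorem derivIter_limit {α : Ordinal} (hα : Order.IsSuccLimit α) :
    derivIter d a α = ⨅ (γ : Ordinal) (_ : γ < α), derivIter d a γ :=
  Ordinal.limitRecOn_limit (h := hα) ..

end DerivIter

/-- The rank function of a well-founded relation on a countable type is bounded by a countable
ordinal. -/
theorem exists_lt_omega_one_forall_rank_lt {W : Type*} [Countable W] (r : W → W → Prop)
    [IsWellFounded W r] :
    ∃ α < (Cardinal.aleph 1).ord, ∀ w, IsWellFounded.rank r w < α := by
  have hlim : Order.IsSuccLimit (Cardinal.aleph 1).ord :=
    Cardinal.isSuccLimit_ord (Cardinal.aleph0_le_aleph 1)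
  have hsup : ∀ {V : Type _} [Countable V] (f : V → Ordinal),
      (∀ v, f v < (Cardinal.aleph 1).ord) → ⨆ v, f v < (Cardinal.aleph 1).ord := by
    intro V _ f hf
    refine Ordinal.iSup_lt_of_lt_cof ?_ hf
    rw [Cardinal.isRegular_aleph_one.cof_ord]
    exact (Cardinal.mk_le_aleph0).trans_lt Cardinal.aleph0_lt_aleph_one
  have hrank : ∀ w, IsWellFounded.rank r w < (Cardinal.aleph 1).ord := by
    intro w
    induction w using IsWellFounded.induction r with
    | ind w ih =>
      rw [IsWellFounded.rank_eq]
      exact hsup _ fun v => hlim.succ_lt (ih v.1 v.2)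
  refine ⟨⨆ w, Order.succ (IsWellFounded.rank r w), hsup _ fun w => hlim.succ_lt (hrank w),
    fun w => (Order.lt_succ _).trans_le (Ordinal.le_iSup _ w)⟩

section Code

variable {E : Type*} [NormedAddCommGroup E] [TopologicalSpace.SeparableSpace E]

/-- The index of a term of the dense sequence of `E` at distance less than `2⁻ⁿ` from `x`. -/
def approxIndex (n : ℕ) (x : E) : ℕ :=
  ((TopologicalSpace.denseRange_denseSeq E).exists_dist_lt x
    (pow_pos (half_pos one_pos) n : (0 : ℝ) < (1 / 2) ^ n)).choose

theorem dist_denseSeq_approxIndex (n : ℕ) (x : E) :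
    dist x (TopologicalSpace.denseSeq E (approxIndex n x)) < (1 / 2) ^ n :=
  ((TopologicalSpace.denseRange_denseSeq E).exists_dist_lt x
    (pow_pos (half_pos one_pos) n : (0 : ℝ) < (1 / 2) ^ n)).choose_spec

theorem dist_le_of_approxIndex_eq {n : ℕ} {x y : E} (h : approxIndex n x = approxIndex n y) :
    dist x y ≤ 2 * (1 / 2) ^ n := by
  have hx := dist_denseSeq_approxIndex n x
  have hy := dist_denseSeq_approxIndex n y
  rw [h] at hx
  have := dist_triangle_right x y (TopologicalSpace.denseSeq E (approxIndex n y))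
  linarith

variable {ι : Type*} (A : ℕ → Set ι) (e : ℕ → ι)

open Classical in
/-- A finite code recording `g`, up to precision `2⁻ⁿ`, at those of the first `n + 1` points of
the enumeration `e` which lie in `A n`. -/
def approxCode (n : ℕ) (g : ι → E) : List ℕ :=
  (List.range (n + 1)).map fun j => if e j ∈ A n then approxIndex n (g (e j)) else 0

@[simp]
theorem length_approxCode (n : ℕ) (g : ι → E) : (approxCode A e n g).length = n + 1 := by
  simp [approxCode]

theorem approxCode_congr {n : ℕ} {g g' : ι → E} (h : ∀ x ∈ A n, g x = g' x) :
    approxCode A e n g = approxCode A e n g' := by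
  refine List.map_congr_left fun j _ => ?_
  split_ifs with hj
  · rw [h _ hj]
  · rfl

theorem approxIndex_eq_of_approxCode_eq {n j : ℕ} {g g' : ι → E}
    (h : approxCode A e n g = approxCode A e n g') (hj : j ≤ n) (hjA : e j ∈ A n) :
    approxIndex n (g (e j)) = approxIndex n (g' (e j)) := by
  have := List.map_inj_left.1 h j (List.mem_range.2 (Nat.lt_succ_of_le hj))
  simpa [hjA] using this

/-- The relation on codes induced by the extension relation of the tree `T`. -/
def codeRel (T : ∀ n, Set (↥(A n) → E)) (v w : List ℕ) : Prop :=
  ∃ (n : ℕ) (g : ι → E), (fun a : ↥(A (n + 1)) => g a) ∈ T (n + 1) ∧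
    v = approxCode A e (n + 1) g ∧ w = approxCode A e n g

theorem wellFounded_codeRel [CompleteSpace E] (hmono : Monotone A) (he : Function.Surjective e)
    (hcover : ∀ x, ∃ n, x ∈ A n) (T : ∀ n, Set (↥(A n) → E))
    (htree : ∀ n (g : ι → E), (fun a : ↥(A (n + 1)) => g a) ∈ T (n + 1) →
      (fun a : ↥(A n) => g a) ∈ T n)
    (hclosed : ∀ n, IsClosed (T n))
    (hwf : ¬ ∃ g : ι → E, ∀ n, (fun a : ↥(A n) => g a) ∈ T n) :
    WellFounded (codeRel A e T) := by
  rw [wellFounded_iff_isEmpty_descending_chain]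
  refine ⟨fun ⟨w, hw⟩ => hwf ?_⟩
  choose n g hgT hv hw using hw
  have hcode : ∀ k, approxCode A e (n k + 1) (g k) = approxCode A e (n (k + 1)) (g (k + 1)) :=
    fun k => (hv k).symm.trans (hw (k + 1))
  have hn : ∀ k, n (k + 1) = n k + 1 := fun k => by
    simpa using (congrArg List.length (hcode k)).symm
  have hk : ∀ k, k ≤ n k := fun k => by
    induction k with
    | zero => exact Nat.zero_le _
    | succ k ih => rw [hn]; omega
  have hmem : ∀ {k m}, m ≤ k → (fun a : ↥(A m) => g k a) ∈ T m := by
    intro k m hm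
    exact Nat.decreasingInduction (motive := fun m _ => (fun a : ↥(A m) => g k a) ∈ T m)
      (fun m _ h => htree m _ h) (hgT k) (hm.trans ((hk k).trans (Nat.le_succ _)))
  have hcauchy : ∀ x, ∃ y, Filter.Tendsto (fun k => g k x) Filter.atTop (𝓝 y) := by
    intro x
    obtain ⟨j, rfl⟩ := he x
    obtain ⟨m, hm⟩ := hcover (e j)
    have hC : CauchySeq fun k => g (k + (m + j)) (e j) := by
      refine cauchySeq_of_le_geometric (1 / 2) 2 (by norm_num) fun k => ?_
      have h := hk (k + (m + j))
      have hc := hcode (k + (m + j))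
      rw [hn] at hc
      have h1 := dist_le_of_approxIndex_eq (approxIndex_eq_of_approxCode_eq A e hc
        (j := j) (by omega) (hmono (by omega) hm))
      rw [Nat.add_right_comm k 1]
      refine h1.trans (mul_le_mul_of_nonneg_left ?_ zero_le_two)
      exact pow_le_pow_of_le_one (by norm_num) (by norm_num) (by omega)
    obtain ⟨y, hy⟩ := cauchySeq_tendsto_of_complete hC
    exact ⟨y, (Filter.tendsto_add_atTop_iff_nat (f := fun k => g k (e j)) _).1 hy⟩
  choose y hy using hcauchy
  refine ⟨y, fun m => (hclosed m).mem_of_tendsto (tendsto_pi_nhds.2 fun a => hy a) ?_⟩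
  filter_upwards [Filter.eventually_ge_atTop m] with k hk using hmem hk

end Code

/-- Let `X` be a separable Banach space and `T` a well-founded closed `A`-tree
on `X` (given by its levels `T n ⊆ X^{A_n}`). Then `h(T) < ω₁`: some countable iterate of the
derivation `T ↦ T'` (keeping only non-maximal elements, i.e. level `n` of `T'` is
`π_n(T ∩ X^{A_{n+1}})`, with intersections at limit stages) is empty. -/
theorem statement8 {X : Type*} [NormedAddCommGroup X] [NormedSpace ℝ X] [CompleteSpace X]
    [TopologicalSpace.SeparableSpace X]
    {ι : Type*} (A : ℕ → Set ι)
    (hmono : ∀ n, A n ⊆ A (n + 1)) (hstrict : ∀ n, A n ≠ A (n + 1))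
    (hcount : ∀ n, (A n).Countable) (h0 : (A 0).Nonempty) (hcover : ∀ x, ∃ n, x ∈ A n)
    (T : ∀ n, Set (↥(A n) → X))
    (htree : ∀ n, ∀ f ∈ T (n + 1), (fun a : ↥(A n) => f (Set.inclusion (hmono n) a)) ∈ T n)
    (hclosed : ∀ n, IsClosed (T n))
    (hwf : ¬ ∃ g : ι → X, ∀ n, (fun a : ↥(A n) => g a.1) ∈ T n) :
    ∃ α < (Cardinal.aleph 1).ord, ∀ n,
      derivIter (fun (S : ∀ n, Set (↥(A n) → X)) n =>
          (fun (f : ↥(A (n + 1)) → X) (a : ↥(A n)) => f (Set.inclusion (hmono n) a)) '' S (n + 1))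
        T α n = ∅ := by
  have hmono' : Monotone A := monotone_nat_of_le_succ hmono
  have : Nonempty ι := h0.nonempty
  have : Countable ι := by
    rw [← Set.countable_univ_iff]
    refine (Set.countable_iUnion hcount).mono fun x _ => Set.mem_iUnion.2 (hcover x)
  obtain ⟨e, he⟩ := exists_surjective_nat ι
  have hW := wellFounded_codeRel A e hmono' he hcover T (fun n g hg => htree n _ hg) hclosed hwf
  let r : ULift (List ℕ) → ULift (List ℕ) → Prop := InvImage (codeRel A e T) ULift.down
  have : IsWellFounded _ r := ⟨InvImage.wf _ hW⟩
  obtain ⟨α, hα, hrank⟩ := exists_lt_omega_one_forall_rank_lt r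
  refine ⟨α, hα, fun n => Set.eq_empty_iff_forall_notMem.2 fun f hf => ?_⟩
  set d : (∀ n, Set (↥(A n) → X)) → ∀ n, Set (↥(A n) → X) := fun S n =>
    (fun (f : ↥(A (n + 1)) → X) (a : ↥(A n)) => f (Set.inclusion (hmono n) a)) '' S (n + 1)
  have hext : ∀ n (f : ↥(A n) → X), ∃ g : ι → X, (fun a : ↥(A n) => g a) = f := by
    classical
    exact fun n f => ⟨fun x => if h : x ∈ A n then f ⟨x, h⟩ else 0, by ext a; simp⟩
  have hle : ∀ β n, derivIter d T β n ⊆ T n := by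
    intro β
    induction β using Ordinal.limitRecOn with
    | zero => intro n; rw [derivIter_zero]
    | add_one β ih =>
      intro n
      rw [derivIter_add_one]
      rintro _ ⟨f, hf, rfl⟩
      exact htree n f (ih _ hf)
    | limit β hβ _ =>
      intro n
      rw [derivIter_limit d T hβ]
      have h : (⨅ (γ : Ordinal) (_ : γ < β), derivIter d T γ) ≤ derivIter d T 0 :=
        iInf₂_le 0 hβ.bot_lt
      rw [derivIter_zero] at h
      exact h n
  have key : ∀ β n (g : ι → X), (fun a : ↥(A n) => g a) ∈ derivIter d T β n →
      β ≤ IsWellFounded.rank r ⟨approxCode A e n g⟩ := by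
    intro β
    induction β using Ordinal.limitRecOn with
    | zero => exact fun _ _ _ => zero_le
    | add_one β ih =>
      intro n g hg
      rw [derivIter_add_one] at hg
      obtain ⟨f, hf, hfg⟩ := hg
      obtain ⟨g', rfl⟩ := hext _ f
      rw [approxCode_congr A e (g' := g') fun x hx => (congrFun hfg ⟨x, hx⟩).symm]
      refine Order.add_one_le_of_lt ((ih _ _ hf).trans_lt (IsWellFounded.rank_lt_of_rel ?_))
      exact ⟨n, g', hle _ _ hf, rfl, rfl⟩
    | limit β hβ ih =>
      intro n g hg
      rw [derivIter_limit d T hβ] at hg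
      refine hβ.le_iff_forall_le.2 fun γ hγ => ih γ hγ n g ?_
      have h : (⨅ (γ : Ordinal) (_ : γ < β), derivIter d T γ) ≤ derivIter d T γ := iInf₂_le γ hγ
      exact h n hg
  obtain ⟨g, rfl⟩ := hext n f
  exact (hrank _).not_ge (key α n g hf)
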